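/- arXiv:1510.01574 — 3 statements merged into one kernel-verified Lean document; each statement's English description precedes it below -/
import Mathlib

section
/- A marked system S = (I,R) generates a regular circular language if and only if its associated graph G = (I,R) is a cograph, i.e., G contains no induced path P4 on four vertices. -/
/-- Conjugacy of words: `w` and `w'` are conjugate iff `w = x ++ y` and `w' = y ++ x`. -/
def WordConj {A : Type*} (w w' : List A) : Prop :=
  ∃ x y : List A, w = x ++ y ∧ w' = y ++ x

/-- One splicing step of a marked system (at the level of full linearizations):
the rule `(a,b)` splices circular words `~(x a)` and `~(y b)` into `~(x a y b)`. -/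
def MarkedStep {A : Type*} (R : Set (A × A)) (L : Set (List A)) (w : List A) : Prop :=
  ∃ (a b : A) (x y : List A), (a, b) ∈ R ∧ x ++ [a] ∈ L ∧ y ++ [b] ∈ L ∧
    WordConj w (x ++ [a] ++ y ++ [b])

/-- The full linearization of the circular language `L(I,R)` generated by the marked
system `(I,R)`: the smallest set of words containing the one-letter words `[a]`, `a ∈ I`,
and closed under the splicing steps (conjugates included). -/
def MarkedLang {A : Type*} (I : Set A) (R : Set (A × A)) : Set (List A) :=
  ⋂₀ {L : Set (List A) | (∀ a ∈ I, [a] ∈ L) ∧ ∀ w, MarkedStep R L w → w ∈ L}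

/-- `RChain R J a b k` : there is a sequence `b_1, …, b_k` of vertices of `J` with
`b_1 = a`, `b_k = b` and `(b_h, b_{h+1}) ∈ R` for all `h`. -/
def RChain {A : Type*} (R : Set (A × A)) (J : Set A) (a b : A) (k : ℕ) : Prop :=
  ∃ l : List A, l.length = k ∧ l.head? = some a ∧ l.getLast? = some b ∧
    (∀ c ∈ l, c ∈ J) ∧ l.Chain' (fun x y => (x, y) ∈ R)

/-- the generated language, as a `Language` -/
def LL {A : Type*} (I : Set A) (R : Set (A × A)) : Language A := MarkedLang I R

theorem wc_iff {A : Type*} (w w' : List A) : WordConj w w' ↔ w ~r w' := by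
  constructor
  · rintro ⟨x, y, rfl, rfl⟩
    exact ⟨x.length, by simp⟩
  · rintro ⟨n, rfl⟩
    rcases Nat.eq_zero_or_pos w.length with h | h
    · have := List.length_eq_zero_iff.1 h
      subst this
      exact ⟨[], [], by simp, by simp⟩
    · refine ⟨w.take (n % w.length), w.drop (n % w.length), by simp, ?_⟩
      rw [← List.rotate_mod, List.rotate_eq_drop_append_take (Nat.mod_lt _ h).le]

theorem rot_app {A : Type*} (x y : List A) : (x ++ y) ~r (y ++ x) :=
  ⟨x.length, by simp⟩

section
variable {A : Type*} {I : Set A} {R : Set (A × A)}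

theorem L_single {a : A} (ha : a ∈ I) : [a] ∈ MarkedLang I R := by
  intro L hL
  exact hL.1 a ha

theorem L_step {w : List A} (h : MarkedStep R (MarkedLang I R) w) : w ∈ MarkedLang I R := by
  intro L hL
  apply hL.2
  obtain ⟨a, b, x, y, h1, h2, h3, h4⟩ := h
  exact ⟨a, b, x, y, h1, h2 L hL, h3 L hL, h4⟩

theorem L_min (P : List A → Prop) (h1 : ∀ a ∈ I, P [a])
    (h2 : ∀ w, MarkedStep R {w | P w} w → P w) {w : List A} (h : w ∈ MarkedLang I R) : P w :=
  h {w | P w} ⟨h1, h2⟩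

theorem L_rot {w w' : List A} (h : w ∈ MarkedLang I R) (hr : w ~r w') : w' ∈ MarkedLang I R := by
  refine L_min (I := I) (R := R) (fun w => ∀ w', w ~r w' → w' ∈ MarkedLang I R) ?_ ?_ h w' hr
  · intro a ha w' hw
    have := List.isRotated_singleton_iff'.1 hw
    subst this
    exact L_single ha
  · rintro w ⟨a, b, x, y, hab, hx, hy, hw⟩ w' hr
    exact L_step ⟨a, b, x, y, hab, hx _ (List.IsRotated.refl _), hy _ (List.IsRotated.refl _),
      (wc_iff _ _).2 (hr.symm.trans ((wc_iff _ _).1 hw))⟩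

theorem L_app {z : List A} {a b : A} (h : z ++ [b] ∈ MarkedLang I R) (ha : a ∈ I)
    (hr : (b, a) ∈ R) : z ++ [b] ++ [a] ∈ MarkedLang I R := by
  refine L_step ⟨b, a, z, [], hr, h, L_single ha, (wc_iff _ _).2 ?_⟩
  simpa using List.IsRotated.refl _

/-- the linear induction principle -/
theorem L_ind (hsym : ∀ a b : A, (a, b) ∈ R → (b, a) ∈ R)
    (P : List A → Prop) (h1 : ∀ a ∈ I, P [a])
    (h2 : ∀ e m f p q, m ∈ MarkedLang I R → e ++ f ∈ MarkedLang I R → P m → P (e ++ f) →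
      (p, q) ∈ R → (∃ z, f ++ e = z ++ [p]) → (∃ z, m = z ++ [q]) → P (e ++ m ++ f))
    {w : List A} (h : w ∈ MarkedLang I R) : P w := by
  have key : ∀ w', w ~r w' → w' ∈ MarkedLang I R ∧ P w' := by
    refine L_min (I := I) (R := R)
      (fun w => ∀ w', w ~r w' → w' ∈ MarkedLang I R ∧ P w') ?_ ?_ h
    · intro a ha w' hw
      have := List.isRotated_singleton_iff'.1 hw
      subst this
      exact ⟨L_single ha, h1 a ha⟩
    · rintro w ⟨a, b, x, y, hab, hx, hy, hw⟩ w' hr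
      have hc : WordConj w' (x ++ [a] ++ y ++ [b]) :=
        (wc_iff _ _).2 (hr.symm.trans ((wc_iff _ _).1 hw))
      refine ⟨L_step ⟨a, b, x, y, hab, (hx _ (List.IsRotated.refl _)).1,
        (hy _ (List.IsRotated.refl _)).1, hc⟩, ?_⟩
      obtain ⟨s, t, rfl, h4⟩ := hc
      have h5 : (x ++ [a]) ++ (y ++ [b]) = t ++ s := by rw [← h4]; simp
      rcases List.append_eq_append_iff.1 h5 with ⟨g, hg1, hg2⟩ | ⟨g, hg1, hg2⟩
      · -- t = xa ++ g, yb = g ++ s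
        have h6 := hy (s ++ g) (by rw [hg2]; exact rot_app _ _)
        have h7 := hx _ (List.IsRotated.refl _)
        have := h2 s (x ++ [a]) g b a h7.1 h6.1 h7.2 h6.2 (hsym _ _ hab) ⟨y, hg2.symm⟩ ⟨x, rfl⟩
        rw [hg1]
        simpa using this
      · -- xa = t ++ g, s = g ++ yb
        have h6 := hx (g ++ t) (by rw [hg1]; exact rot_app _ _)
        have h7 := hy _ (List.IsRotated.refl _)
        have := h2 g (y ++ [b]) t a b h7.1 h6.1 h7.2 h6.2 hab ⟨x, hg1.symm⟩ ⟨y, rfl⟩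
        rw [hg2]
        simpa using this
  exact (key w (List.IsRotated.refl _)).2

/-! ### Cograph implies regular -/

theorem split_core {A : Type*} [DecidableEq A] (r : A → A → Prop) (hs : ∀ a b, r a b → r b a)
    (hp : ∀ a b c d, a ≠ b → a ≠ c → a ≠ d → b ≠ c → b ≠ d → c ≠ d → r a b → r b c → r c d →
      ¬ r a c → ¬ r a d → ¬ r b d → False)
    (B : Finset A) (v : A) (hv : v ∉ B) (T : Set A) (hT : ∃ x ∈ B, x ∈ T) (hT' : ∃ x ∈ B, x ∉ T)
    (hc : ∀ x ∈ B, ∀ y ∈ B, x ∈ T → y ∉ T → ¬ r x y) :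
    ∃ T : Set A, (∃ x ∈ insert v B, x ∈ T) ∧ (∃ x ∈ insert v B, x ∉ T) ∧
      ((∀ x ∈ insert v B, ∀ y ∈ insert v B, x ∈ T → y ∉ T → r x y) ∨
       (∀ x ∈ insert v B, ∀ y ∈ insert v B, x ∈ T → y ∉ T → ¬ r x y)) := by
  obtain ⟨x0, hx0, hx0T⟩ := hT
  obtain ⟨y0, hy0, hy0T⟩ := hT'
  by_cases h1 : ∃ x ∈ B, x ∈ T ∧ r v x
  swap
  · refine ⟨{x | x ∈ T ∧ x ∈ B}, ⟨x0, by simp [hx0], hx0T, hx0⟩, ⟨v, by simp, fun h => hv h.2⟩,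
      Or.inr ?_⟩
    rintro x - y hy ⟨hxT, hxB⟩ hyT hr
    rcases Finset.mem_insert.1 hy with rfl | hyB
    · exact h1 ⟨x, hxB, hxT, hs _ _ hr⟩
    · exact hc x hxB y hyB hxT (fun h => hyT ⟨h, hyB⟩) hr
  by_cases h2 : ∃ x ∈ B, x ∉ T ∧ r v x
  swap
  · refine ⟨{x | x ∉ T ∧ x ∈ B}, ⟨y0, by simp [hy0], hy0T, hy0⟩, ⟨v, by simp, fun h => hv h.2⟩,
      Or.inr ?_⟩
    rintro x - y hy ⟨hxT, hxB⟩ hyT hr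
    rcases Finset.mem_insert.1 hy with rfl | hyB
    · exact h2 ⟨x, hxB, hxT, hs _ _ hr⟩
    · exact hc y hyB x hxB (by by_contra h; exact hyT ⟨h, hyB⟩) hxT (hs _ _ hr)
  by_cases h3 : ∀ x ∈ B, r v x
  · refine ⟨{v}, ⟨v, by simp, rfl⟩, ⟨x0, by simp [hx0], ?_⟩, Or.inl ?_⟩
    · rintro h
      exact hv (h ▸ hx0)
    · rintro x - y hy hx hyv
      rcases Finset.mem_insert.1 hy with rfl | hyB
      · exact absurd rfl hyv
      · rw [show x = v from hx]; exact h3 y hyB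
  push Not at h3
  obtain ⟨u, huB, hu⟩ := h3
  have hc' : ∀ x ∈ B, ∀ y ∈ B, ¬ (x ∈ T ↔ y ∈ T) → ¬ r x y := by
    intro x hx y hy h hr
    by_cases hxT : x ∈ T
    · exact hc x hx y hy hxT (by tauto) hr
    · exact hc y hy x hx (by tauto) hxT (hs _ _ hr)
  obtain ⟨z, hzB, hzu, hvz⟩ : ∃ z ∈ B, ¬ (z ∈ T ↔ u ∈ T) ∧ r v z := by
    obtain ⟨x1, a1, a2, a3⟩ := h1
    obtain ⟨x2, b1, b2, b3⟩ := h2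
    by_cases huT : u ∈ T
    · exact ⟨x2, b1, by tauto, b3⟩
    · exact ⟨x1, a1, by tauto, a3⟩
  refine ⟨{x | x ∈ B ∧ (x ∈ T ↔ u ∈ T) ∧ ¬ r v x}, ⟨u, by simp [huB], huB, Iff.rfl, hu⟩,
    ⟨v, by simp, fun h => hv h.1⟩, Or.inr ?_⟩
  rintro x - y hy ⟨hxB, hxu, hvx⟩ hyT hr
  rcases Finset.mem_insert.1 hy with rfl | hyB
  · exact hvx (hs _ _ hr)
  by_cases hyu : (y ∈ T ↔ u ∈ T)
  · have hvy : r v y := by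
      by_contra h
      exact hyT ⟨hyB, hyu, h⟩
    refine hp x y v z ?_ ?_ ?_ ?_ ?_ ?_ hr (hs _ _ hvy) hvz (fun h => hvx (hs _ _ h))
      (hc' _ hxB _ hzB (by tauto)) (hc' _ hyB _ hzB (by tauto))
    · rintro rfl; exact hvx hvy
    · rintro rfl; exact hv hxB
    · rintro rfl; exact hzu hxu
    · rintro rfl; exact hv hyB
    · rintro rfl; exact hzu hyu
    · rintro rfl; exact hv hzB
  · exact hc' _ hxB _ hyB (by tauto) hr

theorem split_exists {A : Type*} [DecidableEq A] (r : A → A → Prop) (hs : ∀ a b, r a b → r b a)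
    (hp : ∀ a b c d, a ≠ b → a ≠ c → a ≠ d → b ≠ c → b ≠ d → c ≠ d → r a b → r b c → r c d →
      ¬ r a c → ¬ r a d → ¬ r b d → False)
    (B : Finset A) : (∃ x ∈ B, ∃ y ∈ B, x ≠ y) →
    ∃ T : Set A, (∃ x ∈ B, x ∈ T) ∧ (∃ x ∈ B, x ∉ T) ∧
      ((∀ x ∈ B, ∀ y ∈ B, x ∈ T → y ∉ T → r x y) ∨
       (∀ x ∈ B, ∀ y ∈ B, x ∈ T → y ∉ T → ¬ r x y)) := by
  induction B using Finset.induction_on with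
  | empty => rintro ⟨x, hx, -⟩; simp at hx
  | insert v B hv ih =>
    intro h
    by_cases h2 : ∃ x ∈ B, ∃ y ∈ B, x ≠ y
    · obtain ⟨T, hT, hT', hc | hc⟩ := ih h2
      · obtain ⟨T, h1, h2, h3⟩ := split_core (fun a b => ¬ r a b)
          (fun a b h h' => h (hs _ _ h'))
          (fun a b c d h1 h2 h3 h4 h5 h6 ab bc cd ac ad bd =>
            hp b d a c h5 h1.symm h4 h3.symm h6.symm h2 (not_not.1 bd) (hs _ _ (not_not.1 ad))
              (not_not.1 ac) (fun h => ab (hs _ _ h)) bc (fun h => cd (hs _ _ h)))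
          B v hv T hT hT' (fun x hx y hy hxT hyT h => h (hc x hx y hy hxT hyT))
        refine ⟨T, h1, h2, ?_⟩
        rcases h3 with h3 | h3
        · exact Or.inr h3
        · exact Or.inl fun x hx y hy a b => not_not.1 (h3 x hx y hy a b)
      · exact split_core r hs hp B v hv T hT hT' hc
    · push Not at h2
      obtain ⟨u, hu⟩ : ∃ u, u ∈ B := by
        obtain ⟨x, hx, y, hy, hxy⟩ := h
        rcases Finset.mem_insert.1 hx with rfl | hx
        · rcases Finset.mem_insert.1 hy with rfl | hy
          · exact absurd rfl hxy
          · exact ⟨y, hy⟩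
        · exact ⟨x, hx⟩
      have hB : ∀ y ∈ B, y = u := fun y hy => h2 y hy u hu
      refine ⟨{v}, ⟨v, by simp, rfl⟩, ⟨u, by simp [hu], ?_⟩, ?_⟩
      · rintro h; exact hv (h ▸ hu)
      · by_cases hr : r v u
        · left
          rintro x - y hy hx hyv
          rw [show x = v from hx]
          rcases Finset.mem_insert.1 hy with rfl | hyB
          · exact absurd rfl hyv
          · rw [hB y hyB]; exact hr
        · right
          rintro x - y hy hx hyv
          rw [show x = v from hx]
          rcases Finset.mem_insert.1 hy with rfl | hyB
          · exact absurd rfl hyv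
          · rw [hB y hyB]; exact hr

theorem find_adj {A : Type*} (T : Set A) (x : A) (hx : x ∈ T) (l : List A) :
    (∃ y ∈ l, y ∉ T) → ∃ s b a t, l ++ [x] = s ++ b :: a :: t ∧ b ∉ T ∧ a ∈ T := by
  induction l with
  | nil => rintro ⟨y, hy, -⟩; simp at hy
  | cons h l ih =>
    rintro ⟨y, hy, hyT⟩
    by_cases hl : ∃ y ∈ l, y ∉ T
    · obtain ⟨s, b, a, t, h1, h2, h3⟩ := ih hl
      exact ⟨h :: s, b, a, t, by simp [h1], h2, h3⟩
    · push Not at hl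
      have hh : h ∉ T := by
        rcases List.mem_cons.1 hy with rfl | hy
        · exact hyT
        · exact absurd (hl y hy) hyT
      cases l with
      | nil => exact ⟨[], h, x, [], by simp, hh, hx⟩
      | cons a l => exact ⟨[], h, a, l ++ [x], by simp, hh, hl a (by simp)⟩

theorem L_join (hsym : ∀ a b : A, (a, b) ∈ R → (b, a) ∈ R) (T : Set A) (n : ℕ) :
    ∀ w : List A, w.length = n → (∀ c ∈ w, c ∈ I) → (∃ x ∈ w, x ∈ T) → (∃ x ∈ w, x ∉ T) →
      (∀ x ∈ w, ∀ y ∈ w, x ∈ T → y ∉ T → (x, y) ∈ R) → w ∈ MarkedLang I R := by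
  induction n with
  | zero =>
    intro w hw _ hx
    have := List.length_eq_zero_iff.1 hw
    subst this
    obtain ⟨x, hx, -⟩ := hx
    simp at hx
  | succ n ih =>
    intro w hw hI ⟨x, hx, hxT⟩ ⟨y, hy, hyT⟩ hc
    obtain ⟨l1, l2, rfl⟩ := List.append_of_mem hx
    obtain ⟨s, b, a, t, h1, hb, ha⟩ := find_adj T x hxT (l2 ++ l1) ⟨y, by
      simp only [List.mem_append, List.mem_cons] at hy ⊢
      rcases hy with hy | rfl | hy
      · exact Or.inr hy
      · exact absurd hxT hyT
      · exact Or.inl hy, hyT⟩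
    have hrot : ((t ++ s) ++ [b] ++ [a]) ~r (l1 ++ x :: l2) := by
      have e1 : (l1 ++ x :: l2) ~r (l2 ++ l1 ++ [x]) := by
        have := rot_app (l1 ++ [x]) l2
        simpa using this
      rw [h1] at e1
      refine List.IsRotated.trans ?_ e1.symm
      have := rot_app t (s ++ [b, a])
      simpa using this
    refine L_rot ?_ hrot
    generalize t ++ s = z at hrot
    have hmem : ∀ c, c ∈ z ++ [b] ++ [a] ↔ c ∈ l1 ++ x :: l2 := fun c => hrot.mem_iff
    have hlen : (z ++ [b] ++ [a]).length = n + 1 := by rw [← hw]; exact hrot.perm.length_eq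
    generalize l1 ++ x :: l2 = w0 at *
    have hI' : ∀ c ∈ z ++ [b] ++ [a], c ∈ I := fun c hc => hI c ((hmem c).1 hc)
    have hc' : ∀ x ∈ z ++ [b] ++ [a], ∀ y ∈ z ++ [b] ++ [a], x ∈ T → y ∉ T → (x, y) ∈ R :=
      fun x hx y hy => hc x ((hmem x).1 hx) y ((hmem y).1 hy)
    have hab : (a, b) ∈ R := hc' a (by simp) b (by simp) ha hb
    clear hmem hI hc hrot h1 hx hy hw
    by_cases hz : ∃ x ∈ z, x ∈ T
    · obtain ⟨x', hx', hx'T⟩ := hz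
      refine L_app (ih (z ++ [b]) (by simpa using hlen) (fun c hc => hI' c (by simp at hc ⊢; tauto))
        ⟨x', by simp [hx'], hx'T⟩ ⟨b, by simp, hb⟩ ?_) (hI' a (by simp)) (hsym _ _ hab)
      exact fun x hx y hy => hc' x (by simp at hx ⊢; tauto) y (by simp at hy ⊢; tauto)
    · cases z with
      | nil =>
        exact L_app (z := []) (L_single (hI' b (by simp))) (hI' a (by simp)) (hsym _ _ hab)
      | cons b0 z =>
        have hb0 : b0 ∉ T := fun h => hz ⟨b0, by simp, h⟩
        have hr : ((z ++ [b]) ++ [a] ++ [b0]) ~r (b0 :: z ++ [b] ++ [a]) := by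
          have := rot_app ((z ++ [b]) ++ [a]) [b0]
          simpa using this
        refine L_rot (L_app (ih (z ++ [b] ++ [a]) (by simpa using hlen)
          (fun c hc => hI' c (by simp at hc ⊢; tauto))
          ⟨a, by simp, ha⟩ ⟨b, by simp, hb⟩ ?_) (hI' b0 (by simp))
          (hc' a (by simp) b0 (by simp) ha hb0)) hr
        exact fun x hx y hy => hc' x (by simp at hx ⊢; tauto) y (by simp at hy ⊢; tauto)

theorem L_loop {a : A} (ha : a ∈ I) (hr : (a, a) ∈ R) (n : ℕ) :
    List.replicate (n + 1) a ∈ MarkedLang I R := by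
  induction n with
  | zero => exact L_single ha
  | succ n ih =>
    rw [List.replicate_succ'] at ih
    rw [List.replicate_succ', List.replicate_succ']
    exact L_app ih ha hr

/-- connectedness of the alphabet of a word -/
def NoSplit {A : Type*} (R : Set (A × A)) (w : List A) : Prop :=
  ∀ T : Set A, (∃ x ∈ w, x ∈ T) → (∃ x ∈ w, x ∉ T) →
    ∃ x ∈ w, ∃ y ∈ w, x ∈ T ∧ y ∉ T ∧ (x, y) ∈ R

def Good {A : Type*} (I : Set A) (R : Set (A × A)) (w : List A) : Prop :=
  w ≠ [] ∧ (∀ c ∈ w, c ∈ I) ∧ NoSplit R w ∧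
    ((∃ x ∈ w, ∃ y ∈ w, x ≠ y) ∨ w.length = 1 ∨ ∃ x ∈ w, (x, x) ∈ R)

theorem good_of_mem (hsym : ∀ a b : A, (a, b) ∈ R → (b, a) ∈ R) {w : List A}
    (h : w ∈ MarkedLang I R) : Good I R w := by
  refine L_ind hsym (Good I R) ?_ ?_ h
  · intro a ha
    refine ⟨by simp, by simpa using ha, ?_, by simp⟩
    rintro T ⟨x, hx, hxT⟩ ⟨y, hy, hyT⟩
    simp at hx hy
    subst hx hy
    exact absurd hxT hyT
  · rintro e m f p q - - ⟨hm1, hm2, hm3, hm4⟩ ⟨he1, he2, he3, he4⟩ hpq ⟨z, hz⟩ ⟨z', hz'⟩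
    have hp : p ∈ e ++ f := by
      have : p ∈ f ++ e := by rw [hz]; simp
      simp at this ⊢; tauto
    have hq : q ∈ m := by rw [hz']; simp
    have hmem : ∀ c, c ∈ e ++ m ++ f ↔ c ∈ m ∨ c ∈ e ++ f := by
      intro c; simp; tauto
    refine ⟨by simp [hm1], ?_, ?_, ?_⟩
    · intro c hc
      rcases (hmem c).1 hc with h | h
      · exact hm2 c h
      · exact he2 c h
    · intro T ⟨x, hx, hxT⟩ ⟨y, hy, hyT⟩
      simp only [hmem] at *
      by_cases a1 : ∃ x ∈ m, x ∈ T
      · by_cases a2 : ∃ x ∈ m, x ∉ T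
        · obtain ⟨x, h1, y, h2, h3⟩ := hm3 T a1 a2
          exact ⟨x, Or.inl h1, y, Or.inl h2, h3⟩
        · by_cases a3 : ∃ x ∈ e ++ f, x ∈ T
          · have a4 : ∃ x ∈ e ++ f, x ∉ T := by
              rcases hy with hy | hy
              · exact absurd ⟨y, hy, hyT⟩ a2
              · exact ⟨y, hy, hyT⟩
            obtain ⟨x, h1, y, h2, h3⟩ := he3 T a3 a4
            exact ⟨x, Or.inr h1, y, Or.inr h2, h3⟩
          · push Not at a2 a3
            exact ⟨q, Or.inl hq, p, Or.inr hp, a2 q hq, a3 p hp, hsym _ _ hpq⟩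
      · have a3 : ∃ x ∈ e ++ f, x ∈ T := by
          rcases hx with hx | hx
          · exact absurd ⟨x, hx, hxT⟩ a1
          · exact ⟨x, hx, hxT⟩
        by_cases a4 : ∃ x ∈ e ++ f, x ∉ T
        · obtain ⟨x, h1, y, h2, h3⟩ := he3 T a3 a4
          exact ⟨x, Or.inr h1, y, Or.inr h2, h3⟩
        · push Not at a1 a4
          exact ⟨p, Or.inr hp, q, Or.inl hq, a4 p hp, a1 q hq, hpq⟩
    · by_cases h : p = q
      · subst h
        exact Or.inr (Or.inr ⟨p, (hmem p).2 (Or.inl hq), hpq⟩)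
      · exact Or.inl ⟨p, (hmem p).2 (Or.inr hp), q, (hmem q).2 (Or.inl hq), h⟩

theorem mem_of_good (hsym : ∀ a b : A, (a, b) ∈ R → (b, a) ∈ R)
    (hp : ∀ a b c d : A, a ≠ b → a ≠ c → a ≠ d → b ≠ c → b ≠ d → c ≠ d → (a, b) ∈ R →
      (b, c) ∈ R → (c, d) ∈ R → (a, c) ∉ R → (a, d) ∉ R → (b, d) ∉ R → False)
    {w : List A} (h : Good I R w) : w ∈ MarkedLang I R := by
  classical
  obtain ⟨h1, h2, h3, h4⟩ := h
  by_cases h5 : ∃ x ∈ w, ∃ y ∈ w, x ≠ y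
  · obtain ⟨T, hT, hT', hc⟩ := split_exists (fun a b => (a, b) ∈ R) hsym hp w.toFinset
      (by simpa using h5)
    simp only [List.mem_toFinset] at hT hT' hc
    rcases hc with hc | hc
    · exact L_join hsym T _ w rfl h2 hT hT' hc
    · obtain ⟨x, hx, y, hy, hxT, hyT, hr⟩ := h3 T hT hT'
      exact absurd hr (hc x hx y hy hxT hyT)
  · rcases h4 with h4 | h4 | ⟨x, hx, hr⟩
    · exact absurd h4 h5
    · obtain ⟨a, rfl⟩ := List.length_eq_one_iff.1 h4
      exact L_single (h2 a (by simp))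
    · push Not at h5
      have : w = List.replicate (w.length - 1 + 1) x := by
        rw [Nat.sub_add_cancel (List.length_pos_iff.2 h1)]
        exact List.eq_replicate_iff.2 ⟨rfl, fun b hb => h5 b hb x hx⟩
      rw [this]
      exact L_loop (h2 x hx) hr _

theorem regular_of_free {A : Type} [Fintype A] {I : Set A} {R : Set (A × A)}
    (hsym : ∀ a b : A, (a, b) ∈ R → (b, a) ∈ R)
    (hp : ∀ a b c d : A, a ≠ b → a ≠ c → a ≠ d → b ≠ c → b ≠ d → c ≠ d → (a, b) ∈ R →
      (b, c) ∈ R → (c, d) ∈ R → (a, c) ∉ R → (a, d) ∉ R → (b, d) ∉ R → False) :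
    Language.IsRegular (MarkedLang I R : Language A) := by
  change (LL I R).IsRegular
  rw [Language.isRegular_iff_finite_range_leftQuotient]
  let f : List A → Set A × Fin 3 := fun w => ({c | c ∈ w}, ⟨min w.length 2, by omega⟩)
  have hf : ∀ w w', f w = f w' → Good I R w → Good I R w' := by
    intro w w' h ⟨h1, h2, h3, h4⟩
    simp only [f, Prod.mk.injEq, Fin.mk.injEq] at h
    obtain ⟨ha, hb⟩ := h
    have hm : ∀ c, c ∈ w' ↔ c ∈ w := fun c => (Set.ext_iff.1 ha c).symm
    have : 0 < w.length := List.length_pos_iff.2 h1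
    refine ⟨List.length_pos_iff.1 (by omega), by simpa only [hm] using h2,
      by simpa only [NoSplit, hm] using h3, ?_⟩
    simp only [hm]
    have : w'.length = 1 ↔ w.length = 1 := by omega
    rw [this]; exact h4
  have hf' : ∀ w w', f w = f w' → w ∈ MarkedLang I R → w' ∈ MarkedLang I R :=
    fun w w' h hw => mem_of_good hsym hp (hf _ _ h (good_of_mem hsym hw))
  have happ : ∀ x x' y, f x = f x' → f (x ++ y) = f (x' ++ y) := by
    intro x x' y h
    simp only [f, Prod.mk.injEq, Fin.mk.injEq] at h ⊢
    obtain ⟨ha, hb⟩ := h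
    constructor
    · ext c
      have := Set.ext_iff.1 ha c
      simp only [Set.mem_setOf_eq] at this
      simp [this]
    · simp only [List.length_append]; omega
  have hq : ∀ x x', f x = f x' → Language.leftQuotient (LL I R) x =
      Language.leftQuotient (LL I R) x' := by
    intro x x' h
    ext y
    exact ⟨hf' _ _ (happ x x' y h), hf' _ _ (happ x' x y h.symm)⟩
  have : ∃ g : Set A × Fin 3 → Language A,
      Language.leftQuotient (LL I R) = g ∘ f := by
    refine ⟨Function.extend f (Language.leftQuotient (LL I R)) ⊥, ?_⟩
    funext x
    exact ((Function.FactorsThrough.extend_apply (fun a b h => hq a b h) _ x).symm)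
  obtain ⟨g, hg⟩ := this
  rw [hg]
  exact (Set.finite_range g).subset (Set.range_comp_subset_range f g)

/-! ### An induced path implies non regular -/

inductive Stut {A : Type*} : List A → List A → Prop
  | nil (v) : Stut [] v
  | skip (b x v) : Stut x v → Stut x (b :: v)
  | use (b x v) : Stut x (b :: v) → Stut (b :: x) (b :: v)

theorem Stut.pre {A : Type*} {x v : List A} (h : Stut x v) (v' : List A) : Stut x (v' ++ v) := by
  induction v' with
  | nil => exact h
  | cons b v' ih => exact .skip _ _ _ ih

theorem Stut.app {A : Type*} {x1 v1 x2 v2 : List A} (h : Stut x1 v1) (h2 : Stut x2 v2) :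
    Stut (x1 ++ x2) (v1 ++ v2) := by
  induction h with
  | nil v => exact h2.pre v
  | skip b x v _ ih => exact .skip _ _ _ ih
  | use b x v _ ih => exact .use _ _ _ ih

theorem Stut.mono {A : Type*} {x v v' : List A} (h : Stut x v) (hv : v.Sublist v') :
    Stut x v' := by
  induction h generalizing v' with
  | nil v => exact .nil _
  | skip b x v _ ih => exact ih ((List.sublist_cons_self b v).trans hv)
  | use b x v _ ih =>
    have h1 := ih hv
    obtain ⟨r1, r2, rfl, hb, hr⟩ := List.cons_sublist_iff.1 hv
    clear h1
    obtain ⟨s, t, rfl⟩ := List.append_of_mem hb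
    have : Stut x (b :: (t ++ r2)) :=
      ih (List.Sublist.cons_cons _ (hr.trans (List.sublist_append_right _ _)))
    have := (Stut.use _ _ _ this).pre s
    simpa using this

theorem Stut.last {A : Type*} {x v : List A} (q : A) (k : ℕ) (h : Stut x (v ++ [q])) :
    Stut (x ++ List.replicate k q) (v ++ [q]) := by
  generalize hw : v ++ [q] = w at h
  induction h generalizing v with
  | nil w =>
    subst hw
    refine Stut.pre ?_ v
    simp only [List.nil_append]
    induction k with
    | zero => exact .nil _
    | succ k ih => exact .use _ _ _ ih
  | skip b x w h ih =>
    cases v with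
    | nil =>
      simp at hw
      obtain ⟨rfl, rfl⟩ := hw
      cases h
      have : Stut ([] ++ List.replicate k q) [q] := by
        simp only [List.nil_append]
        clear ih
        induction k with
        | zero => exact .nil _
        | succ k ih => exact .use _ _ _ ih
      exact this
    | cons c v =>
      simp at hw
      exact .skip _ _ _ (ih hw.2)
  | use b x w h ih => exact .use _ _ _ (ih hw)

theorem Stut.dup {A : Type*} {x1 x3 v : List A} {q : A} (k : ℕ) (h : Stut (x1 ++ q :: x3) v) :
    Stut (x1 ++ List.replicate k q ++ q :: x3) v := by
  generalize hw : x1 ++ q :: x3 = w at h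
  induction h generalizing x1 with
  | nil v => simp at hw
  | skip b x v h ih => exact .skip _ _ _ (ih hw)
  | use b x v h ih =>
    cases x1 with
    | nil =>
      simp at hw
      obtain ⟨rfl, rfl⟩ := hw
      simp only [List.nil_append]
      clear ih
      induction k with
      | zero => exact .use _ _ _ h
      | succ k ih' => exact .use _ _ _ ih'
    | cons c x1 =>
      simp at hw
      obtain ⟨rfl, rfl⟩ := hw
      exact .use _ _ _ (ih rfl)

theorem Stut.tail {A : Type*} {x v : List A} {q : A} (h : Stut (q :: x) v) : Stut x v := by
  generalize hw : q :: x = w at h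
  induction h with
  | nil v => simp at hw
  | skip b x v h ih => exact .skip _ _ _ (ih hw)
  | use b x v h ih =>
    simp at hw
    obtain ⟨rfl, rfl⟩ := hw
    exact h

/-- `n`-fold repetition of the two-letter word `xy`. -/
def rep2 {A : Type*} (x y : A) : ℕ → List A
  | 0 => []
  | n + 1 => x :: y :: rep2 x y n

theorem rep2_snoc {A : Type*} (x y : A) (n : ℕ) : rep2 x y (n + 1) = rep2 x y n ++ [x, y] := by
  induction n with
  | zero => rfl
  | succ n ih =>
    have e : ∀ k, rep2 x y (k + 1) = x :: y :: rep2 x y k := fun _ => rfl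
    rw [e (n + 1), ih, ← List.cons_append, ← List.cons_append, ← e n, ih]

theorem stut_rep {A : Type*} {b c : A} (hbc : b ≠ c) (n : ℕ) : ∀ m,
    Stut (rep2 c b m) (b :: rep2 c b n) → m ≤ n := by
  induction n with
  | zero =>
    intro m h
    cases m with
    | zero => exact le_rfl
    | succ m =>
      exfalso
      simp only [rep2] at h
      cases h with
      | skip _ _ _ h => cases h
      | use _ _ _ h => exact hbc rfl
  | succ n ih =>
    intro m h
    cases m with
    | zero => omega
    | succ m =>
      have : Stut (rep2 c b m) (b :: rep2 c b n) := by
        simp only [rep2] at h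
        cases h with
        | use _ _ _ h => exact absurd rfl hbc
        | skip _ _ _ h =>
          cases h with
          | skip _ _ _ h => exact h.tail.tail
          | use _ _ _ h =>
            cases h with
            | use _ _ _ h => exact absurd rfl hbc
            | skip _ _ _ h => exact h.tail
      have := ih m this
      omega

theorem L_const (hsym : ∀ a b : A, (a, b) ∈ R → (b, a) ∈ R) {a d : A} (had : (a, d) ∉ R)
    {w : List A} (h : w ∈ MarkedLang I R) :
    (∀ c ∈ w, c = a ∨ c = d) → ∀ x ∈ w, ∀ y ∈ w, x = y := by
  intro hw x hx y hy
  by_contra hxy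
  obtain ⟨-, -, h3, -⟩ := good_of_mem hsym h
  obtain ⟨x', hx', y', hy', e1, e2, hr⟩ := h3 {x} ⟨x, hx, rfl⟩ ⟨y, hy, fun h => hxy h.symm⟩
  have e1 : x' = x := e1
  have e2 : y' ≠ x := e2
  subst e1
  rcases hw x' hx' with rfl | rfl
  · rcases hw y' hy' with rfl | rfl
    · exact e2 rfl
    · exact had hr
  · rcases hw y' hy' with rfl | rfl
    · exact had (hsym _ _ hr)
    · exact e2 rfl

theorem L_const' (hsym : ∀ a b : A, (a, b) ∈ R → (b, a) ∈ R) {a d : A} (had : (a, d) ∉ R)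
    {w : List A} (h : w ∈ MarkedLang I R) (hw : ∀ c ∈ w, c = a ∨ c = d) {q : A} (hq : q ∈ w) :
    w = List.replicate w.length q :=
  List.eq_replicate_iff.2 ⟨rfl, fun x hx => L_const hsym had h hw x hx q hq⟩

theorem L_stut (hsym : ∀ a b : A, (a, b) ∈ R → (b, a) ∈ R) {a b c d : A}
    (had : (a, d) ∉ R) (hac : (a, c) ∉ R) (hbd : (b, d) ∉ R) (φ : A → A)
    (ha : φ a = b) (hd : φ d = c) (h2 : a ≠ b) (h3 : a ≠ c) (h4 : d ≠ b) (h5 : d ≠ c)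
    {w : List A} (h : w ∈ MarkedLang I R) :
    ∀ u v, w = u ++ v → v ≠ [] → (∀ x ∈ u, x = a ∨ x = d) → (∀ x ∈ v, x = b ∨ x = c) →
      Stut (u.map φ).reverse v := by
  have F1 : ∀ p q, (p, q) ∈ R → (p = a ∨ p = d) → (q = a ∨ q = d) → p = q := by
    rintro p q hr (rfl | rfl) (rfl | rfl)
    · rfl
    · exact absurd hr had
    · exact absurd (hsym _ _ hr) had
    · rfl
  have F2 : ∀ p q, (p, q) ∈ R → (p = a ∨ p = d) → (q = b ∨ q = c) → φ p = q := by
    rintro p q hr (rfl | rfl) (rfl | rfl)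
    · exact ha
    · exact absurd hr hac
    · exact absurd (hsym _ _ hr) hbd
    · exact hd
  refine L_ind hsym (fun w => ∀ u v, w = u ++ v → v ≠ [] → (∀ x ∈ u, x = a ∨ x = d) →
    (∀ x ∈ v, x = b ∨ x = c) → Stut (u.map φ).reverse v) ?_ ?_ h
  · intro x _ u v he hv _ _
    cases u with
    | nil => exact .nil _
    | cons y u => simp at he; exact absurd he.2.2 hv
  · rintro e m f p q hm hef ihm ihef hpq ⟨z, hz⟩ ⟨z', hz'⟩ u v he hv hu hvv
    -- case C handled first as a general fact
    have caseC : ∀ u3, f = u3 ++ v → u = e ++ m ++ u3 → Stut (u.map φ).reverse v := by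
      rintro u3 rfl rfl
      have hmq := L_const' hsym had hm (fun x hx => hu x (by simp [hx]))
        (q := q) (by rw [hz']; simp)
      have hqq : q = a ∨ q = d := hu q (by rw [hz']; simp)
      have ih := ihef (e ++ u3) v (by simp) hv
        (fun x hx => hu x (by simp at hx ⊢; tauto)) hvv
      rw [hmq]
      simp only [List.map_append, List.reverse_append, List.map_replicate,
        List.reverse_replicate] at ih ⊢
      rcases List.eq_nil_or_concat e with rfl | ⟨e', p', rfl⟩
      · simp only [List.append_nil, List.map_nil, List.reverse_nil] at ih hz ⊢
        obtain ⟨v', q', rfl⟩ := (List.eq_nil_or_concat v).resolve_left hv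
        simp only [List.concat_eq_append] at *
        rw [← List.append_assoc] at hz
        have hpq' := (List.append_inj' hz rfl).2
        simp only [List.cons.injEq, and_true] at hpq'
        subst hpq'
        have := F2 q q' (hsym _ _ hpq) hqq (hvv q' (by simp))
        rw [this]
        exact ih.last _ _
      · simp only [List.concat_eq_append] at *
        rw [← List.append_assoc] at hz
        have hpq' := (List.append_inj' hz rfl).2
        simp only [List.cons.injEq, and_true] at hpq'
        subst hpq'
        have := F1 p' q hpq (hu p' (by simp)) hqq
        subst this
        simp only [List.map_append, List.reverse_append, List.map_cons, List.map_nil,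
          List.reverse_cons, List.reverse_nil, List.nil_append, List.singleton_append] at ih ⊢
        have := ih.dup (k := m.length)
        simpa using this
    rw [List.append_assoc] at he
    rcases List.append_eq_append_iff.1 he with ⟨g, hg1, hg2⟩ | ⟨g, hg1, hg2⟩
    · -- u = e ++ g, m ++ f = g ++ v
      rcases List.append_eq_append_iff.1 hg2 with ⟨g', hg3, hg4⟩ | ⟨v1, hg3, hg4⟩
      · exact caseC g' hg4 (by rw [hg1, hg3]; simp)
      · -- m = g ++ v1, v = v1 ++ f
        by_cases hv1 : v1 = []
        · subst hv1
          exact caseC [] (by simpa using hg4.symm) (by rw [hg1, hg3]; simp)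
        subst hg1 hg3 hg4
        have ih1 := ihm g v1 rfl hv1 (fun x hx => hu x (by simp [hx]))
          (fun x hx => hvv x (by simp [hx]))
        by_cases hf : f = []
        · subst hf
          simp only [List.append_nil, List.nil_append] at *
          have hpe : p ∈ e := by rw [hz]; simp
          have hee := L_const' hsym had hef (fun x hx => hu x (by simp [hx])) hpe
          obtain ⟨v', q', rfl⟩ := (List.eq_nil_or_concat v1).resolve_left hv1
          simp only [List.concat_eq_append] at *
          rw [← List.append_assoc] at hz'
          have hpq' := (List.append_inj' hz' rfl).2
          simp only [List.cons.injEq, and_true] at hpq'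
          subst hpq'
          have := F2 p q' hpq (hu p (by simp [hpe])) (hvv q' (by simp))
          rw [hee]
          simp only [List.map_append, List.reverse_append, List.map_replicate,
            List.reverse_replicate]
          rw [this]
          exact ih1.last _ _
        · have ih2 := ihef e f rfl hf (fun x hx => hu x (by simp [hx]))
            (fun x hx => hvv x (by simp [hx]))
          have := ih1.app ih2
          simpa using this
    · -- e = u ++ g, v = g ++ (m ++ f)
      subst hg1 hg2
      by_cases hgf : g ++ f = []
      · simp at hgf
        obtain ⟨rfl, rfl⟩ := hgf
        simp only [List.append_nil, List.nil_append] at *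
        have hpe : p ∈ u := by rw [hz]; simp
        have hee := L_const' hsym had hef hu hpe
        have := F2 p q hpq (hu p hpe) (hvv q (by simp [hz']))
        rw [hee, hz']
        simp only [List.map_replicate, List.reverse_replicate]
        rw [this]
        exact (Stut.nil (z' ++ [q])).last q _
      · have := ihef u (g ++ f) (by simp) hgf hu (fun x hx => hvv x (by simp at hx ⊢; tauto))
        exact this.mono (List.Sublist.append (List.Sublist.refl _) (List.sublist_append_right _ _))

theorem L_word {a b c d : A} (haI : a ∈ I) (hbI : b ∈ I) (hcI : c ∈ I) (hdI : d ∈ I)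
    (hsym : ∀ a b : A, (a, b) ∈ R → (b, a) ∈ R)
    (hab : (a, b) ∈ R) (hbc : (b, c) ∈ R) (hcd : (c, d) ∈ R) (n : ℕ) :
    ∃ z, rep2 a d n ++ (b :: rep2 c b n) = z ++ [b] ∧ z ++ [b] ∈ MarkedLang I R := by
  induction n with
  | zero => exact ⟨[], rfl, L_single hbI⟩
  | succ n ih =>
    obtain ⟨z, hz, hL⟩ := ih
    refine ⟨a :: d :: (z ++ [b, c]), ?_, ?_⟩
    · rw [rep2_snoc c b]
      have : rep2 a d (n + 1) ++ (b :: (rep2 c b n ++ [c, b])) =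
        a :: d :: ((rep2 a d n ++ (b :: rep2 c b n)) ++ [c, b]) := by simp [rep2]
      rw [this, hz]
      simp
    · have h1 := L_app hL hcI hbc
      have h2 := L_app h1 hdI hcd
      have h3 : ([d] ++ (z ++ [b])) ++ [c] ∈ MarkedLang I R := by
        refine L_rot h2 ?_
        have := rot_app (z ++ [b] ++ [c]) [d]
        simpa using this
      have h4 := L_app h3 hbI (hsym _ _ hbc)
      have h5 := L_app h4 haI (hsym _ _ hab)
      refine L_rot h5 ?_
      have := rot_app ([d] ++ (z ++ [b]) ++ [c] ++ [b]) [a]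
      simpa using this

end

theorem not_regular {A : Type} [Fintype A] {I : Set A} {R : Set (A × A)}
    (hsym : ∀ a b : A, (a, b) ∈ R → (b, a) ∈ R) {a b c d : A}
    (haI : a ∈ I) (hbI : b ∈ I) (hcI : c ∈ I) (hdI : d ∈ I)
    (nab : a ≠ b) (nac : a ≠ c) (nad : a ≠ d) (nbc : b ≠ c) (nbd : b ≠ d) (ncd : c ≠ d)
    (hab : (a, b) ∈ R) (hbc : (b, c) ∈ R) (hcd : (c, d) ∈ R)
    (hac : (a, c) ∉ R) (had : (a, d) ∉ R) (hbd : (b, d) ∉ R) :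
    ¬ Language.IsRegular (MarkedLang I R : Language A) := by
  classical
  change ¬ (LL I R).IsRegular
  rw [Language.isRegular_iff_finite_range_leftQuotient]
  intro hfin
  have key : ∀ m n, rep2 a d m ++ (b :: rep2 c b n) ∈ MarkedLang I R → m ≤ n := by
    intro m n h
    have hu : ∀ m, ∀ x ∈ rep2 a d m, x = a ∨ x = d := by
      intro m
      induction m with
      | zero => simp [rep2]
      | succ m ih => simp only [rep2, List.mem_cons]; grind
    have hv : ∀ m, ∀ x ∈ rep2 c b m, x = b ∨ x = c := by
      intro m
      induction m with
      | zero => simp [rep2]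
      | succ m ih => simp only [rep2, List.mem_cons]; grind
    have := L_stut hsym had hac hbd (fun x => if x = a then b else c) (by simp)
      (by simp [nad.symm]) nab nac nbd.symm ncd.symm h (rep2 a d m) (b :: rep2 c b n) rfl (by simp)
      (hu m) (by intro x hx; rcases List.mem_cons.1 hx with rfl | hx
                 · exact Or.inl rfl
                 · exact hv n x hx)
    have e : ∀ m, ((rep2 a d m).map (fun x => if x = a then b else c)).reverse = rep2 c b m := by
      intro m
      induction m with
      | zero => rfl
      | succ m ih =>
        rw [rep2_snoc c b, ← ih]
        simp [rep2, nad.symm]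
    rw [e] at this
    exact stut_rep nbc n m this
  have hmem : ∀ n, rep2 a d n ++ (b :: rep2 c b n) ∈ MarkedLang I R := by
    intro n
    obtain ⟨z, hz, hL⟩ := L_word haI hbI hcI hdI hsym hab hbc hcd n
    rw [hz]; exact hL
  have hinj : Function.Injective
      (fun n => Language.leftQuotient (LL I R) (rep2 a d n)) := by
    have le : ∀ m n, Language.leftQuotient (LL I R) (rep2 a d m) =
        Language.leftQuotient (LL I R) (rep2 a d n) → m ≤ n := by
      intro m n h
      apply key
      have h1 : (b :: rep2 c b n) ∈
        Language.leftQuotient (LL I R) (rep2 a d n) := hmem n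
      rw [← h] at h1
      exact h1
    intro m n h
    exact le_antisymm (le m n h) (le n m h.symm)
  exact Set.infinite_range_of_injective hinj
    (hfin.subset (by rintro _ ⟨n, rfl⟩; exact ⟨rep2 a d n, rfl⟩))

/-- A marked system `(I, R)` generates a regular circular language if and only if its
associated graph is a cograph, i.e., contains no induced path `P4` on four vertices. -/
theorem stmt10 {A : Type} [Fintype A] (I : Set A) (R : Set (A × A))
    (hsub : ∀ p ∈ R, p.1 ∈ I ∧ p.2 ∈ I)
    (hsym : ∀ a b : A, (a, b) ∈ R → (b, a) ∈ R)
    (hocc : ∀ a ∈ I, ∃ b, (a, b) ∈ R) :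
    Language.IsRegular (MarkedLang I R : Language A) ↔
      ¬ ∃ a b c d : A, a ∈ I ∧ b ∈ I ∧ c ∈ I ∧ d ∈ I ∧
          a ≠ b ∧ a ≠ c ∧ a ≠ d ∧ b ≠ c ∧ b ≠ d ∧ c ≠ d ∧
          (a, b) ∈ R ∧ (b, c) ∈ R ∧ (c, d) ∈ R ∧
          (a, c) ∉ R ∧ (a, d) ∉ R ∧ (b, d) ∉ R := by
  constructor
  · rintro hreg ⟨a, b, c, d, ha, hb, hc, hd, h1, h2, h3, h4, h5, h6, h7, h8, h9, h10, h11, h12⟩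
    exact not_regular hsym ha hb hc hd h1 h2 h3 h4 h5 h6 h7 h8 h9 h10 h11 h12 hreg
  · intro h
    refine regular_of_free hsym ?_
    intro a b c d h1 h2 h3 h4 h5 h6 h7 h8 h9 h10 h11 h12
    exact h ⟨a, b, c, d, (hsub _ h7).1, (hsub _ h7).2, (hsub _ h8).2, (hsub _ h9).2,
      h1, h2, h3, h4, h5, h6, h7, h8, h9, h10, h11, h12⟩
end

section
/- (Generalized Myhill–Nerode theorem.) A language L ⊆ A* is regular if and only if L is ≤-closed under some monotone well quasi-order ≤ on A*, i.e., there exists a quasi-order ≤ on A* that is monotone and a well quasi-order and such that y ∈ L and y ≤ x imply x ∈ L. -/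
/-- Generalized Myhill–Nerode theorem: a language `L ⊆ A*` is regular iff it is
`≤`-closed under some monotone well quasi-order `≤` on `A*`. -/
theorem stmt15 {A : Type} [Fintype A] (L : Language A) :
    L.IsRegular ↔
      ∃ le : List A → List A → Prop,
        (∀ x, le x x) ∧
        (∀ x y z : List A, le x y → le y z → le x z) ∧
        (∀ u v u' v' : List A, le u v → le u' v' → le (u ++ u') (v ++ v')) ∧
        (∀ f : ℕ → List A, ∃ i j : ℕ, i < j ∧ le (f i) (f j)) ∧
        (∀ y ∈ L, ∀ x : List A, le y x → x ∈ L) := by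
  constructor
  · rintro ⟨σ, _, M, rfl⟩
    refine ⟨fun x y => (fun s => M.evalFrom s x) = (fun s => M.evalFrom s y), fun _ => rfl,
      fun _ _ _ h1 h2 => h1.trans h2, ?_, ?_, ?_⟩
    · intro u v u' v' h h'
      funext s
      have h1 := congrFun h s
      have h2 := congrFun h' (M.evalFrom s v)
      rw [DFA.evalFrom_of_append, DFA.evalFrom_of_append, h1, h2]
    · intro f
      obtain ⟨i, j, hij, h⟩ := Finite.exists_ne_map_eq_of_infinite
        (fun n : ℕ => fun s => M.evalFrom s (f n))
      rcases lt_or_gt_of_ne hij with h1 | h1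
      · exact ⟨i, j, h1, h⟩
      · exact ⟨j, i, h1, h.symm⟩
    · intro y hy x h
      have := congrFun h M.start
      rw [DFA.mem_accepts, DFA.eval] at hy ⊢
      rwa [← this]
  · rintro ⟨le, hr, ht, hm, hw, hc⟩
    apply Language.IsRegular.of_finite_range_leftQuotient
    by_contra hinf
    have hinf : (Set.range L.leftQuotient).Infinite := hinf
    haveI : IsPreorder (List A) le := { refl := hr, trans := ht }
    have hw' : WellQuasiOrdered le := hw
    let e := hinf.natEmbedding
    choose x hx using fun n => (e n).2
    obtain ⟨g, hg⟩ := hw'.exists_monotone_subseq x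
    have hmono : ∀ m n, m ≤ n → ∀ y, x (g m) ++ y ∈ L → x (g n) ++ y ∈ L :=
      fun m n h y hy => hc _ hy _ (hm _ _ _ _ (hg m n h) (hr y))
    have hex : ∀ n, ∃ y, x (g (n+1)) ++ y ∈ L ∧ x (g n) ++ y ∉ L := by
      intro n
      by_contra! hcon
      have h1 : L.leftQuotient (x (g n)) = L.leftQuotient (x (g (n+1))) := by
        ext y
        exact ⟨hmono _ _ (Nat.le_succ n) y, hcon y⟩
      rw [hx, hx] at h1
      have h2 := g.injective (e.injective (Subtype.ext h1))
      omega
    choose y hy1 hy2 using hex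
    obtain ⟨i, j, hij, h⟩ := hw y
    exact hy2 j (hmono (i+1) j hij _ (hc _ (hy1 i) _ (hm _ _ _ _ (hr _) h)))
end

section
/- A (1,3)-complete circular splicing system S = (A, I, R) generates a regular circular language if and only if Lin(I) is unavoidable in A*. -/
/-- A flat splicing rule `(α, β, γ, δ)`; its components are called handles. -/
structure FlatRule (A : Type*) where
  α : List A
  β : List A
  γ : List A
  δ : List A

/-- One flat splicing step: applying the rule `(α,β,γ,δ)` to `u = xαβy` and
`v = γzδ` produces `w = xαγzδβy`. -/
def FlatStep {A : Type*} (R : Set (FlatRule A)) (L : Set (List A)) (w : List A) : Prop :=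
  ∃ r ∈ R, ∃ x y z : List A,
    x ++ r.α ++ r.β ++ y ∈ L ∧ r.γ ++ z ++ r.δ ∈ L ∧
    w = x ++ r.α ++ r.γ ++ z ++ r.δ ++ r.β ++ y

/-- The language generated by the flat splicing system `(A, I, R)`: the smallest
language containing `I` and closed under all productions by rules of `R`. -/
def FlatLang {A : Type*} (I : Set (List A)) (R : Set (FlatRule A)) : Set (List A) :=
  ⋂₀ {L : Set (List A) | I ⊆ L ∧ ∀ w, FlatStep R L w → w ∈ L}

/-- One (1,3)-CSSH splicing step (at the level of full linearizations): the rule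
`(a, b)` (that is, `a#1$b#1`) splices circular words `~(x a)` and `~(y b)` into
`~(x a y b)`. -/
def CSSHStep {A : Type*} (R : Set (A × A)) (L : Set (List A)) (w : List A) : Prop :=
  ∃ (a b : A) (x y : List A), (a, b) ∈ R ∧ x ++ [a] ∈ L ∧ y ++ [b] ∈ L ∧
    WordConj w (x ++ [a] ++ y ++ [b])

/-- The full linearization of the circular language generated by the (1,3)-CSSH system
`(A, ~I, R)`, where `I` is a linearization of the initial circular language. -/
def CSSHLang {A : Type*} (I : Set (List A)) (R : Set (A × A)) : Set (List A) :=
  ⋂₀ {L : Set (List A) |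
      (∀ w ∈ I, ∀ w', WordConj w w' → w' ∈ L) ∧ ∀ w, CSSHStep R L w → w ∈ L}

/-- The flat rules `(a, 1, 1, b)` associated with a set `R` of pairs of letters. -/
def insRules {A : Type*} (R : Set (A × A)) : Set (FlatRule A) :=
  {r | ∃ a b : A, (a, b) ∈ R ∧ r = ⟨[a], [], [], [b]⟩}

/-- `Y` is unavoidable in `A*`: there is `k0` such that every word of length `> k0`
has a factor in `Y`. -/
def Unavoidable {A : Type*} (Y : Set (List A)) : Prop :=
  ∃ k0 : ℕ, ∀ x : List A, k0 < x.length → ∃ y ∈ Y, y <:+: x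

namespace Stmt19

/-- Insertion of one word of `I`. -/
def Step {A : Type} (I : Set (List A)) (x y : List A) : Prop :=
  ∃ u z v : List A, z ∈ I ∧ x = u ++ v ∧ y = u ++ z ++ v

/-- Iterated insertion. -/
def Le {A : Type} (I : Set (List A)) : List A → List A → Prop :=
  Relation.ReflTransGen (Step I)

variable {A : Type} {I : Set (List A)}

theorem Le.rfl' {x : List A} : Le I x x := Relation.ReflTransGen.refl

theorem Le.trans' {x y z : List A} (h : Le I x y) (h' : Le I y z) : Le I x z :=
  Relation.ReflTransGen.trans h h'

theorem Le.ctx {x y : List A} (p q : List A) (h : Le I x y) :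
    Le I (p ++ x ++ q) (p ++ y ++ q) := by
  induction h with
  | refl => exact Le.rfl'
  | tail _ hs ih =>
    obtain ⟨u, z, v, hz, rfl, rfl⟩ := hs
    exact Relation.ReflTransGen.tail ih ⟨p ++ u, z, v ++ q, hz, by simp, by simp⟩

theorem Le.left {x y : List A} (p : List A) (h : Le I x y) : Le I (p ++ x) (p ++ y) := by
  simpa using Le.ctx p [] h

theorem Le.right {x y : List A} (q : List A) (h : Le I x y) : Le I (x ++ q) (y ++ q) := by
  simpa using Le.ctx [] q h

theorem Le.app {x y x' y' : List A} (h : Le I x y) (h' : Le I x' y') :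
    Le I (x ++ x') (y ++ y') := (h.right x').trans' (h'.left y)

theorem Le.length {x y : List A} (h : Le I x y) : x.length ≤ y.length := by
  induction h with
  | refl => exact le_rfl
  | tail _ hs ih =>
    obtain ⟨u, z, v, hz, rfl, rfl⟩ := hs
    simp at *; omega

theorem Le.of_mem {z : List A} (hz : z ∈ I) : Le I [] z :=
  Relation.ReflTransGen.single ⟨[], z, [], hz, by simp, by simp⟩

theorem Le.ins {u v w : List A} (h : Le I [] w) : Le I (u ++ v) (u ++ w ++ v) := by
  simpa using Le.ctx u v h

theorem Le.split {x x' w y : List A} (h : Le I w y) : w = x ++ x' →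
    ∃ y1 y2, y = y1 ++ y2 ∧ Le I x y1 ∧ Le I x' y2 := by
  intro hw
  subst hw
  induction h with
  | refl => exact ⟨x, x', rfl, Le.rfl', Le.rfl'⟩
  | tail _ hs ih =>
    obtain ⟨u, z, v, hz, rfl, rfl⟩ := hs
    obtain ⟨y1, y2, he, h1, h2⟩ := ih
    rcases List.append_eq_append_iff.1 he with ⟨t, rfl, rfl⟩ | ⟨t, rfl, rfl⟩
    · exact ⟨u ++ z ++ t, y2, by simp, h1.trans' (Le.ins (Le.of_mem hz)), h2⟩
    · exact ⟨y1, t ++ z ++ v, by simp, h1, h2.trans' (Le.ins (Le.of_mem hz))⟩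

theorem Le.single {a : A} {y : List A} (h : Le I [a] y) :
    ∃ d1 d2, y = d1 ++ a :: d2 ∧ Le I [] d1 ∧ Le I [] d2 := by
  induction h with
  | refl => exact ⟨[], [], rfl, Le.rfl', Le.rfl'⟩
  | tail _ hs ih =>
    obtain ⟨u, z, v, hz, rfl, rfl⟩ := hs
    obtain ⟨y1, y2, he, h1, h2⟩ := ih
    rcases List.append_eq_append_iff.1 he with ⟨t, rfl, rfl⟩ | ⟨t, rfl, ht⟩
    · exact ⟨u ++ z ++ t, y2, by simp, h1.trans' (Le.ins (Le.of_mem hz)), h2⟩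
    · cases t with
      | nil =>
        simp at ht
        subst ht
        exact ⟨y1 ++ z, y2, by simp, Le.app h1 (Le.of_mem hz), h2⟩
      | cons b t =>
        simp at ht
        obtain ⟨rfl, rfl⟩ := ht
        exact ⟨y1, t ++ z ++ v, by simp, h1, h2.trans' (Le.ins (Le.of_mem hz))⟩

theorem Le.conj (hconj : ∀ w ∈ I, ∀ w', WordConj w w' → w' ∈ I) {w : List A}
    (h : Le I [] w) : ∀ p q, w = p ++ q → Le I [] (q ++ p) := by
  induction h with
  | refl =>
    intro p q h
    have := List.append_eq_nil_iff.1 h.symm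
    obtain ⟨rfl, rfl⟩ := this
    exact Le.rfl'
  | tail _ hs ih =>
    obtain ⟨u, z, v, hz, rfl, rfl⟩ := hs
    intro p q he
    rw [List.append_assoc] at he
    rcases List.append_eq_append_iff.1 he with ⟨t, rfl, ht⟩ | ⟨t, rfl, rfl⟩
    · rcases List.append_eq_append_iff.1 ht with ⟨s, rfl, rfl⟩ | ⟨s, rfl, rfl⟩
      · have := ih (u ++ s) q (by simp)
        have h2 := this.trans' (by simpa using Le.ins (u := q ++ u) (v := s) (Le.of_mem hz))
        simpa using h2
      · have h1 := ih u v rfl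
        have h2 : Le I [] (s ++ t) := Le.of_mem (hconj _ hz _ ⟨t, s, rfl, rfl⟩)
        have h3 := h2.trans' (Le.ins h1)
        simpa using h3
    · have := ih p (t ++ v) (by simp)
      have h2 := this.trans' (by simpa using Le.ins (u := t) (v := v ++ p) (Le.of_mem hz))
      simpa using h2

theorem Le.cancel_aux (hconj : ∀ w ∈ I, ∀ w', WordConj w w' → w' ∈ I) (n : ℕ) :
    ∀ u s : List A, u.length = n → Le I u (u ++ s) → Le I [] s := by
  induction n using Nat.strong_induction_on with
  | _ n ih =>
  intro u s hn h
  cases u with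
  | nil => simpa using h
  | cons a u =>
    obtain ⟨y1, y2, he, h1, h2⟩ := h.split (x := [a]) (x' := u) rfl
    obtain ⟨d1, d2, rfl, hd1, hd2⟩ := h1.single
    have h3 : Le I u (d2 ++ y2) := by simpa using Le.app hd2 h2
    rw [List.append_assoc] at he
    cases d1 with
    | nil =>
      simp at he
      rw [← he] at h3
      exact ih u.length (by simp at hn; omega) u s rfl h3
    | cons b d1 =>
      rcases List.append_eq_append_iff.1 he with ⟨t, ht, rfl⟩ | ⟨r, hr, hr2⟩
      · rw [ht] at hd1
        have h4 := Le.conj hconj hd1 _ _ rfl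
        exact h4.trans' (by simpa using (h3.left (t ++ [a])))
      · have h4 : Le I r (b :: d1 ++ r) := by simpa using Le.app hd1 (Le.rfl' (x := r))
        rw [← hr] at h4
        have h5 := h4.trans' (by simpa using h3.left [a] : Le I (a :: u) (a :: (d2 ++ y2)))
        have h6 : a :: (d2 ++ y2) = r ++ s := by simpa using hr2
        rw [h6] at h5
        refine ih r.length ?_ r s rfl h5
        have := congrArg List.length hr
        simp at this hn
        omega

theorem Le.cancel (hconj : ∀ w ∈ I, ∀ w', WordConj w w' → w' ∈ I) {u v v' : List A}
    (h : Le I (u ++ v) (u ++ v')) : Le I v v' := by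
  obtain ⟨y1, y2, he, h1, h2⟩ := h.split rfl
  rcases List.append_eq_append_iff.1 he with ⟨s, rfl, rfl⟩ | ⟨s, rfl, rfl⟩
  · have h3 := Le.cancel_aux hconj _ u s rfl h1
    simpa using Le.app h3 h2
  · have := h1.length
    simp at this
    subst this
    simpa using h2

instance : IsPreorder (List A) (Le I) where
  refl _ := Le.rfl'
  trans _ _ _ := Le.trans'

open Set.PartiallyWellOrderedOn in
theorem wqo [Fintype A] (hne : [] ∉ I)
    (hconj : ∀ w ∈ I, ∀ w', WordConj w w' → w' ∈ I) (hu : Unavoidable I) :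
    (Set.univ : Set (List A)).PartiallyWellOrderedOn (Le I) := by
  obtain ⟨k0, hk⟩ := hu
  rw [iff_not_exists_isMinBadSeq List.length]
  rintro ⟨f, hf1, hf2⟩
  have hfin : {l : List A | l.length < k0 + 2}.Finite := List.finite_length_lt A _
  have hp : {l : List A | l.length < k0 + 2}.PartiallyWellOrderedOn (Eq) :=
    hfin.partiallyWellOrderedOn
  obtain ⟨g, hg⟩ := hp.exists_monotone_subseq (f := fun n => (f n).take (k0 + 1))
    (fun n => by simp)
  have hg0 : ∀ n, (f (g 0)).take (k0 + 1) = (f (g n)).take (k0 + 1) := fun n => hg 0 n (Nat.zero_le _)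
  by_cases hlen : (f (g 0)).length ≤ k0 ∧ (f (g 1)).length ≤ k0
  · have h1 := hg0 1
    rw [List.take_of_length_le (by omega), List.take_of_length_le (by omega)] at h1
    apply hf1.2 (g 0) (g 1) (g.lt_iff_lt.2 Nat.zero_lt_one)
    rw [h1]
    exact Le.rfl'
  have hlp : k0 < ((f (g 0)).take (k0 + 1)).length := by
    have h1 := congrArg List.length (hg0 1)
    simp only [List.length_take] at h1 ⊢
    omega
  obtain ⟨z, hz, u, t, hut⟩ := hk _ hlp
  have hzl : 0 < z.length := List.length_pos_iff.2 (by rintro rfl; exact hne hz)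
  obtain ⟨v, hv⟩ : ∃ v : ℕ → List A, ∀ n, f (g n) = u ++ z ++ v n :=
    ⟨fun n => t ++ (f (g n)).drop (k0 + 1), fun n => by
      conv_lhs => rw [← List.take_append_drop (k0 + 1) (f (g n)), ← hg0 n, ← hut]
      simp⟩
  have hf' := hf2 (g 0) (fun n => if n < g 0 then f n else u ++ v (n - g 0))
      (fun m hm => (if_pos hm).symm) (by
        simp only [if_neg (lt_irrefl (g 0)), Nat.sub_self, hv]
        simp; omega)
  rw [IsBadSeq] at hf'
  push Not at hf'
  obtain ⟨m, n, mn, hmn⟩ := hf' fun n => Set.mem_univ _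
  by_cases hn : n < g 0
  · apply hf1.2 m n mn
    rwa [if_pos hn, if_pos (mn.trans hn)] at hmn
  · obtain ⟨n', rfl⟩ := Nat.exists_eq_add_of_le (not_lt.1 hn)
    rw [if_neg hn, add_comm (g 0) n', Nat.add_sub_cancel_right] at hmn
    split_ifs at hmn with hm
    · apply hf1.2 m (g n') (lt_of_lt_of_le hm (g.monotone n'.zero_le))
      refine hmn.trans' ?_
      rw [hv]
      exact Le.ins (Le.of_mem hz)
    · rw [← Nat.sub_lt_iff_lt_add' (le_of_not_gt hm)] at mn
      apply hf1.2 _ _ (g.lt_iff_lt.2 mn)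
      rw [hv, hv]
      exact Le.left _ (Le.cancel hconj hmn)

theorem regular_of_wqo (L : Language A) (hL : ∀ x y, Le I x y → x ∈ L → y ∈ L)
    (hw : (Set.univ : Set (List A)).PartiallyWellOrderedOn (Le I)) : L.IsRegular := by
  apply Language.IsRegular.of_finite_range_leftQuotient
  by_contra hinf
  have hinf : (Set.range L.leftQuotient).Infinite := hinf
  let e := hinf.natEmbedding
  have he : ∀ n, ∃ u, L.leftQuotient u = (e n).1 := fun n => (e n).2
  choose u hu using he
  obtain ⟨g, hg⟩ := hw.exists_monotone_subseq (f := u) (fun n => Set.mem_univ _)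
  have hex : ∀ n, ∃ v, u (g (n+1)) ++ v ∈ L ∧ u (g n) ++ v ∉ L := by
    intro n
    by_contra hcon
    push Not at hcon
    have : L.leftQuotient (u (g n)) = L.leftQuotient (u (g (n+1))) := by
      ext v
      rw [Language.mem_leftQuotient, Language.mem_leftQuotient]
      exact ⟨hL _ _ (Le.right v (hg n (n+1) (Nat.le_succ n))), hcon v⟩
    rw [hu, hu] at this
    have h2 := g.injective (e.injective (Subtype.ext this))
    omega
  choose v hv1 hv2 using hex
  obtain ⟨i, j, hij, h⟩ := hw.exists_lt (f := v) (fun n => Set.mem_univ _)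
  exact hv2 j (hL _ _ (Le.app (hg (i+1) j hij) h) (hv1 i))

theorem lang_eq (hne : [] ∉ I)
    (hconj : ∀ w ∈ I, ∀ w', WordConj w w' → w' ∈ I) :
    CSSHLang I (Set.univ : Set (A × A)) = {w | Le I [] w ∧ w ≠ []} := by
  apply Set.Subset.antisymm
  · apply Set.sInter_subset_of_mem
    refine ⟨?_, ?_⟩
    · intro w hw w' hc
      have := hconj w hw w' hc
      exact ⟨Le.of_mem this, by rintro rfl; exact hne this⟩
    · rintro w ⟨a, b, x, y, -, hx, hy, p, q, rfl, hpq⟩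
      have h1 : Le I [] (q ++ p) := by
        rw [← hpq]
        simpa using Le.app hx.1 hy.1
      refine ⟨Le.conj hconj h1 _ _ rfl, ?_⟩
      intro h
      have := List.append_eq_nil_iff.1 h
      obtain ⟨rfl, rfl⟩ := this
      simp at hpq
  · rintro w ⟨hw, hw0⟩ L ⟨hL1, hL2⟩
    have key : ∀ w, Le I [] w → w = [] ∨ ∀ w', WordConj w w' → w' ∈ L := by
      intro w h
      induction h with
      | refl => exact Or.inl rfl
      | tail _ hs ih =>
        obtain ⟨u, z, v, hz, rfl, rfl⟩ := hs
        right
        rcases ih with ih | ih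
        · obtain ⟨rfl, rfl⟩ := List.append_eq_nil_iff.1 ih
          intro w' hc
          exact hL1 z hz w' (by simpa using hc)
        · rcases List.eq_nil_or_concat (v ++ u) with h0 | ⟨x, a, hx⟩
          · obtain ⟨rfl, rfl⟩ := List.append_eq_nil_iff.1 h0
            intro w' hc
            exact hL1 z hz w' (by simpa using hc)
          rcases List.eq_nil_or_concat z with h0 | ⟨y, b, hy⟩
          · exact absurd (h0 ▸ hz) hne
          rintro w' ⟨p, q, hpq, rfl⟩
          have hxL : x ++ [a] ∈ L := by
            have := ih (v ++ u) ⟨u, v, rfl, rfl⟩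
            rw [hx] at this; simpa using this
          have hyL : y ++ [b] ∈ L := by
            have := hL1 z hz z ⟨z, [], by simp, by simp⟩
            rw [hy] at this; simpa using this
          have hx' : v ++ u = x ++ [a] := by simpa using hx
          have hy' : z = y ++ [b] := by simpa using hy
          apply hL2
          refine ⟨a, b, x, y, Set.mem_univ _, hxL, hyL, ?_⟩
          have e1 : x ++ [a] ++ y ++ [b] = v ++ (u ++ z) := by
            rw [List.append_assoc (x ++ [a]), ← hx', ← hy']; simp
          rw [e1]
          -- q ++ p is conjugate to v ++ (u ++ z)
          rcases List.append_eq_append_iff.1 hpq with ⟨t, rfl, rfl⟩ | ⟨t, h1, rfl⟩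
          · exact ⟨q ++ (u ++ z), t, by simp, by simp⟩
          · rw [h1]
            exact ⟨t, v ++ p, by simp, by simp⟩
    rcases key w hw with h | h
    · exact absurd h hw0
    · exact h w ⟨w, [], by simp, by simp⟩

theorem bound (m : ℕ) (hm : ∀ z ∈ I, z.length ≤ m) (hne : [] ∉ I) {w : List A} (h : Le I [] w) :
    ∀ x y, w = x ++ y → (∀ z ∈ I, ¬ z <:+: x) → w.length ≤ m * y.length := by
  induction h with
  | refl => intros; simp
  | tail _ hs ih =>
    obtain ⟨u, z, v, hz, rfl, rfl⟩ := hs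
    intro x y he hx
    have hzm := hm z hz
    have hzl : 0 < z.length := List.length_pos_iff.2 (by rintro rfl; exact hne hz)
    rw [List.append_assoc] at he
    rcases List.append_eq_append_iff.1 he with ⟨t, rfl, ht⟩ | ⟨t, rfl, rfl⟩
    · rcases List.append_eq_append_iff.1 ht with ⟨s, rfl, rfl⟩ | ⟨s, rfl, rfl⟩
      · exact absurd ⟨u, s, by simp⟩ (hx z hz)
      · have h1 := ih u v rfl (fun z' hz' hi => hx z' hz' (hi.trans ⟨[], t, by simp⟩))
        cases s with
        | nil => exact absurd ⟨u, [], by simp⟩ (hx _ hz)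
        | cons b s =>
          simp only [List.length_append, List.length_cons] at *
          nlinarith [Nat.zero_le (m * s.length)]
    · have h1 := ih x (t ++ v) (by simp) hx
      simp only [List.length_append] at *
      nlinarith [Nat.mul_le_mul hzm hzl]

theorem ext_exists (hconj : ∀ w ∈ I, ∀ w', WordConj w w' → w' ∈ I)
    (halph : ∀ a : A, ∃ w ∈ I, a ∈ w) (x : List A) : ∃ y, Le I [] (x ++ y) := by
  induction x with
  | nil => exact ⟨[], Le.rfl'⟩
  | cons a x ih =>
    obtain ⟨y, hy⟩ := ih
    obtain ⟨w, hw, ha⟩ := halph a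
    obtain ⟨p, q, rfl⟩ := List.append_of_mem ha
    have h1 : Le I [] ([a] ++ (q ++ p)) :=
      Le.of_mem (hconj _ hw _ ⟨p, a :: q, rfl, by simp⟩)
    refine ⟨y ++ (q ++ p), ?_⟩
    simpa using h1.trans' (Le.ins hy)

theorem unavoidable_of_regular (hfin : I.Finite) (hne : [] ∉ I)
    (hconj : ∀ w ∈ I, ∀ w', WordConj w w' → w' ∈ I)
    (halph : ∀ a : A, ∃ w ∈ I, a ∈ w) (L : Language A)
    (hL : ∀ w, w ∈ L ↔ Le I [] w ∧ w ≠ []) (hreg : L.IsRegular) : Unavoidable I := by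
  classical
  have hq := hreg.finite_range_leftQuotient
  obtain ⟨m, hm⟩ := (hfin.image List.length).bddAbove
  have hm' : ∀ z ∈ I, z.length ≤ m := fun z hz => hm ⟨z, hz, rfl⟩
  let c : Language A → List A := fun q => if h : ∃ v, v ∈ q then h.choose else []
  have hc : ∀ q : Language A, (∃ v, v ∈ q) → c q ∈ q := fun q h => by
    simp only [c, dif_pos h]; exact h.choose_spec
  obtain ⟨K, hK⟩ := (hq.image (fun q => (c q).length)).bddAbove
  refine ⟨m * K, fun x hx => ?_⟩
  by_contra hcon
  push Not at hcon
  have hx0 : x ≠ [] := by rintro rfl; simp at hx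
  obtain ⟨y, hy⟩ := ext_exists hconj halph x
  have h1 : x ++ c (L.leftQuotient x) ∈ L := by
    have := hc (L.leftQuotient x) ⟨y, (hL _).2 ⟨hy, by simp [hx0]⟩⟩
    exact this
  have h2 : (c (L.leftQuotient x)).length ≤ K := hK ⟨_, ⟨x, rfl⟩, rfl⟩
  have h3 := bound m hm' hne ((hL _).1 h1).1 x _ rfl hcon
  have h4 := Nat.mul_le_mul_left m h2
  simp only [List.length_append] at h3
  omega

end Stmt19

/-- A (1,3)-complete circular splicing system `(A, I, R)` (here `I` is given by its
finite conjugacy-closed full linearization, not containing the empty word, with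
`alph(Lin(I)) = A`, and `R` consists of all rules `a#1$b#1`, `a, b ∈ A`) generates a
regular circular language if and only if `Lin(I)` is unavoidable in `A*`. -/
theorem stmt19 {A : Type} [Fintype A] (I : Set (List A))
    (hfin : I.Finite) (hne : [] ∉ I)
    (hconj : ∀ w ∈ I, ∀ w', WordConj w w' → w' ∈ I)
    (halph : ∀ a : A, ∃ w ∈ I, a ∈ w) :
    Language.IsRegular (CSSHLang I (Set.univ : Set (A × A)) : Language A) ↔
      Unavoidable I := by
  have hL : ∀ w, w ∈ (CSSHLang I (Set.univ : Set (A × A)) : Language A) ↔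
      Stmt19.Le I [] w ∧ w ≠ [] := by
    intro w
    have h := Stmt19.lang_eq hne hconj
    exact (Set.ext_iff.1 h w)
  constructor
  · exact Stmt19.unavoidable_of_regular hfin hne hconj halph _ hL
  · intro hu
    refine Stmt19.regular_of_wqo (I := I) _ ?_ (Stmt19.wqo hne hconj hu)
    intro x y hxy hx
    have hx := (hL x).1 hx
    refine (hL y).2 ?_
    refine ⟨hx.1.trans' hxy, ?_⟩
    rintro rfl
    have := hxy.length
    simp at this
    exact hx.2 this
end
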